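/- Assume n ≥ 4 and m ≥ 2. The function E_m(X_1, …, X_m) = tr(X_1)⋯tr(X_m)·tr(X_1^{-1}⋯X_m^{-1}) + tr(X_1^{-1})⋯tr(X_m^{-1})·tr(X_1⋯X_m) cannot be written as a polynomial with coefficients in k in the observables q_{r_1,…,r_m}, as r_1, …, r_m range over all integers. -/

import Mathlib

noncomputable section

open scoped Classical

/-- The Laurent polynomial ring `k[x_{11}^{±1}, …, x_{mn}^{±1}]` in `m` arrays
of `n` variables each. -/
abbrev LaurentM (k : Type) [Field k] (m n : ℕ) :=
  AddMonoidAlgebra k (Fin m × Fin n → ℤ)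

/-- `T r = tr(X_1^{r_1} ⋯ X_m^{r_m}) = ∑_j ∏_h x_{hj}^{r_h}` as a Laurent
polynomial. -/
def trM (k : Type) [Field k] (m n : ℕ) (r : Fin m → ℤ) : LaurentM k m n :=
  ∑ j : Fin n, AddMonoidAlgebra.single
    (fun p : Fin m × Fin n => if p.2 = j then r p.1 else 0) (1 : k)

/-- The observable
`q_{r_1,…,r_m} = tr(X_1^{r_1}⋯X_m^{r_m}) · tr(X_1^{-r_1}⋯X_m^{-r_m})`. -/
def qM (k : Type) [Field k] (m n : ℕ) (r : Fin m → ℤ) : LaurentM k m n :=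
  trM k m n r * trM k m n (-r)

/-- The triplet-type invariant
`E_m = tr(X_1)⋯tr(X_m)·tr(X_1^{-1}⋯X_m^{-1}) +
tr(X_1^{-1})⋯tr(X_m^{-1})·tr(X_1⋯X_m)`. -/
def EM (k : Type) [Field k] (m n : ℕ) : LaurentM k m n :=
  (∏ h : Fin m, trM k m n (fun h' => if h' = h then 1 else 0)) *
      trM k m n (fun _ => -1) +
    (∏ h : Fin m, trM k m n (fun h' => if h' = h then -1 else 0)) *
      trM k m n (fun _ => 1)

/-- The `K[ε]`-point of the torus `(x_{hj})` given by `x_{0j} = I ^ ℓ_j * (1 + d_j ε)`,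
`x_{1j} = I ^ ℓ_j` and `x_{hj} = 1` for `h ≥ 2`, where `ℓ = (0, 1, 2, 0, …, 0)` and
`d = (1, 0, 1, 0, …, 0)`, as a character of the group of exponents. -/
def dualCharacter {K : Type} [Field K] {I : K} (hI : I ≠ 0) (m n : ℕ) :
    Multiplicative (Fin (m + 2) × Fin (n + 4) → ℤ) →* DualNumber K where
  toFun a :=
    TrivSqZeroExt.inl (I ^ (a.toAdd (0, 1) + a.toAdd (1, 1) +
        2 * (a.toAdd (0, 2) + a.toAdd (1, 2)))) *
      (1 + TrivSqZeroExt.inr ((a.toAdd (0, 0) + a.toAdd (0, 2) : ℤ) : K))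
  map_one' := by simp
  map_mul' a b := by
    have hpow (x y z w x' y' z' w' : ℤ) :
        I ^ (x + x' + (y + y') + 2 * (z + z' + (w + w'))) =
          I ^ (x + y + 2 * (z + w)) * I ^ (x' + y' + 2 * (z' + w')) := by
      rw [← zpow_add₀ hI]
      ring_nf
    simp only [toAdd_mul, Pi.add_apply, hpow]
    apply TrivSqZeroExt.ext
    · simp
    · simp
      ring

/-- Evaluation of Laurent polynomials at the point `dualCharacter`. -/
def dualEval (k : Type) [Field k] {K : Type} [Field K] [Algebra k K] {I : K} (hI : I ≠ 0)
    (m n : ℕ) : LaurentM k (m + 2) (n + 4) →ₐ[k] DualNumber K :=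
  AddMonoidAlgebra.lift k (DualNumber K) _ (dualCharacter hI m n)

section Evaluation

variable {k : Type} [Field k] {K : Type} [Field K] [Algebra k K] {I : K} (hI : I ≠ 0)
  {m n : ℕ} (r : Fin (m + 2) → ℤ)

lemma dualEval_trM :
    dualEval k hI m n (trM k (m + 2) (n + 4) r) =
      TrivSqZeroExt.inl ((n : K) + 2 + I ^ (r 0 + r 1) + I ^ (2 * (r 0 + r 1))) +
        TrivSqZeroExt.inr ((r 0 : K) * (1 + I ^ (2 * (r 0 + r 1)))) := by
  have h01 : (0 : Fin (n + 4)) ≠ 1 := (Fin.succ_ne_zero 0).symm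
  have h02 : (0 : Fin (n + 4)) ≠ 2 := (Fin.succ_ne_zero 1).symm
  have h12 : (1 : Fin (n + 4)) ≠ 2 :=
    (Fin.succ_injective (n + 3)).ne (Fin.succ_ne_zero 0).symm
  have h0 (j : Fin (n + 1)) : (0 : Fin (n + 4)) ≠ j.succ.succ.succ := (Fin.succ_ne_zero _).symm
  have h1 (j : Fin (n + 1)) : (1 : Fin (n + 4)) ≠ j.succ.succ.succ :=
    (Fin.succ_injective _).ne (Fin.succ_ne_zero _).symm
  have h2 (j : Fin (n + 1)) : (2 : Fin (n + 4)) ≠ j.succ.succ.succ :=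
    (Fin.succ_injective _).ne ((Fin.succ_injective _).ne (Fin.succ_ne_zero _).symm)
  have e2 : (Fin.succ (Fin.succ 0) : Fin (n + 4)) = 2 := rfl
  have e1 : (Fin.succ 0 : Fin (n + 4)) = 1 := rfl
  simp only [dualEval, trM, map_sum, AddMonoidAlgebra.lift_single, one_smul]
  rw [Fin.sum_univ_succ, Fin.sum_univ_succ, Fin.sum_univ_succ, e2, e1]
  apply TrivSqZeroExt.ext
  · simp [dualCharacter, h0, h1, h2, h01, h02, h12, h01.symm, h02.symm, h12.symm]
    ring
  · simp [dualCharacter, h0, h1, h2, h01, h02, h12, h01.symm, h02.symm, h12.symm]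
    ring

lemma snd_dualEval_qM (hI2 : I ^ 2 = -1) :
    (dualEval k hI m n (qM k (m + 2) (n + 4) r)).snd = 0 := by
  have h4 : I ^ (4 : ℤ) = 1 := by
    norm_cast
    linear_combination (I ^ 2 - 1) * hI2
  have h2 (s : ℤ) : I ^ (2 * s) = I ^ s * I ^ s := by rw [two_mul, zpow_add₀ hI]
  have hs (s : ℤ) : I ^ s * I ^ s * (I ^ s * I ^ s) = 1 := by
    rw [← h2, ← h2, ← mul_assoc, zpow_mul]
    norm_num [h4]
  simp only [qM, map_mul, dualEval_trM, TrivSqZeroExt.snd_mul, TrivSqZeroExt.fst_add,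
    TrivSqZeroExt.snd_add, TrivSqZeroExt.fst_inl, TrivSqZeroExt.snd_inl, TrivSqZeroExt.fst_inr,
    TrivSqZeroExt.snd_inr, Pi.neg_apply, smul_eq_mul, MulOpposite.smul_eq_mul_unop,
    MulOpposite.unop_op, h2, Int.cast_neg, ← neg_add]
  have hne : I ^ (r 0 + r 1) ≠ 0 := zpow_ne_zero _ hI
  have := hs (r 0 + r 1)
  rw [zpow_neg]
  generalize I ^ (r 0 + r 1) = z at *
  field_simp
  linear_combination (r 0 : K) * (n + 1) * this

lemma dualEval_prod_trM {e : ℤ} (he : I ^ (2 * e) = -1) :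
    dualEval k hI m n (∏ h, trM k (m + 2) (n + 4) fun h' => if h' = h then e else 0) =
      TrivSqZeroExt.inl ((n + 1 + I ^ e) ^ 2 * (n + 4) ^ m) := by
  have h0 (j : Fin m) : (0 : Fin (m + 2)) ≠ j.succ.succ := (Fin.succ_ne_zero _).symm
  have h1 (j : Fin m) : (1 : Fin (m + 2)) ≠ j.succ.succ :=
    (Fin.succ_injective _).ne (Fin.succ_ne_zero _).symm
  simp only [map_prod, dualEval_trM]
  rw [Fin.prod_univ_succ, Fin.prod_univ_succ]
  simp only [Fin.succ_zero_eq_one, h0, h1, he, if_true, if_false, zero_ne_one, one_ne_zero,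
    add_zero, zero_add, mul_zero, zpow_zero, Int.cast_zero, zero_mul, add_neg_cancel,
    TrivSqZeroExt.inr_zero, Finset.prod_const, Finset.card_univ, Fintype.card_fin]
  rw [TrivSqZeroExt.inl_pow, ← TrivSqZeroExt.inl_mul, ← TrivSqZeroExt.inl_mul]
  congr 1
  ring

lemma snd_dualEval_EM (hI2 : I ^ 2 = -1) :
    (dualEval k hI m n (EM k (m + 2) (n + 4))).snd = -8 * I * (n + 1) * (n + 4) ^ m := by
  have hinv : I⁻¹ = -I := inv_eq_of_mul_eq_one_right (by linear_combination -hI2)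
  have h2 : I ^ (2 : ℤ) = -1 := by exact_mod_cast hI2
  have hn2 : I ^ (-2 : ℤ) = -1 := by rw [zpow_neg, h2]; norm_num
  have h4 : I ^ (4 : ℤ) = 1 := by
    norm_cast
    linear_combination (I ^ 2 - 1) * hI2
  have hn4 : I ^ (-4 : ℤ) = 1 := by rw [zpow_neg, h4, inv_one]
  simp only [EM, map_add, map_mul, dualEval_trM,
    dualEval_prod_trM (e := 1) hI h2, dualEval_prod_trM (e := -1) hI (by simpa using hn2)]
  simp [h2, hn2, h4, hn4, hinv]
  ring

end Evaluation

/-- For `n ≥ 4` and `m ≥ 2`, the function `E_m` is not a polynomial in the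
observables `q_{r_1,…,r_m}`, `r_1, …, r_m ∈ ℤ`. -/
theorem stmt18 (k : Type) [Field k] [CharZero k] (m n : ℕ)
    (hm : 2 ≤ m) (hn : 4 ≤ n) :
    EM k m n ∉
      Algebra.adjoin k {v : LaurentM k m n | ∃ r : Fin m → ℤ, v = qM k m n r} := by
  obtain ⟨m, rfl⟩ := Nat.exists_eq_add_of_le' hm
  obtain ⟨n, rfl⟩ := Nat.exists_eq_add_of_le' hn
  intro hE
  obtain ⟨I, hI2⟩ := IsAlgClosed.exists_pow_nat_eq (-1 : AlgebraicClosure k) two_pos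
  have hI : I ≠ 0 := by
    rintro rfl
    simp at hI2
  have hzero : (dualEval k hI m n (EM k (m + 2) (n + 4))).snd = 0 := by
    generalize EM k (m + 2) (n + 4) = E at hE
    induction hE using Algebra.adjoin_induction with
    | mem x hx =>
      obtain ⟨r, rfl⟩ := hx
      exact snd_dualEval_qM hI r hI2
    | algebraMap c =>
      rw [AlgHom.commutes, TrivSqZeroExt.algebraMap_eq_inl', TrivSqZeroExt.snd_inl]
    | add x y _ _ hx hy => simp [hx, hy]
    | mul x y _ _ hx hy => simp [hx, hy]
  have : CharZero (AlgebraicClosure k) := charZero_of_injective_algebraMap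
    (algebraMap k (AlgebraicClosure k)).injective
  rw [snd_dualEval_EM hI hI2] at hzero
  have h1 : (n : AlgebraicClosure k) + 1 ≠ 0 := by exact_mod_cast n.succ_ne_zero
  have h4 : (n : AlgebraicClosure k) + 4 ≠ 0 := by exact_mod_cast (n + 3).succ_ne_zero
  simp [hI, h1, h4] at hzero
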